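/- Fix n ≥ 1 and 1 ≤ k ≤ 1+n, and let ω be a k-form on V = ℝ^{1+n}. For every observer U, the energy e(U) := (1/2)( |E_U|² + |B_U|² ) vanishes if and only if ω = 0. Consequently, the energy tensor T of ω is the zero bilinear form if and only if ω = 0. -/

import Mathlib

namespace Paper

noncomputable section

/-- The vector space `V = ℝ^{1+n}`. -/
abbrev V (n : ℕ) := Fin (n + 1) → ℝ

/-- The standard basis vectors `e₀, …, e_n`. -/
def eb (n : ℕ) (i : Fin (n + 1)) : V n := Pi.single i 1

/-- The signs `ε₀ = 1`, `ε_i = -1` for `i ≠ 0`. -/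
def eps (n : ℕ) (i : Fin (n + 1)) : ℝ := if i = 0 then 1 else -1

/-- The Minkowski bilinear form `η(x,y) = x₀y₀ − Σᵢ xᵢyᵢ`. -/
def mink (n : ℕ) (x y : V n) : ℝ := ∑ i, eps n i * x i * y i

/-- An observer: a unitary timelike vector oriented to the future. -/
def IsObserver (n : ℕ) (U : V n) : Prop := mink n U U = 1 ∧ 0 < mink n U (eb n 0)

open Classical in
/-- The induced scalar product of two (raw) `k`-forms:
`⟨ω, ω̄⟩ = Σ_{i₁ < ⋯ < i_k} ε_{i₁}⋯ε_{i_k} ω(e_{i₁},…,e_{i_k}) ω̄(e_{i₁},…,e_{i_k})`. -/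
def finner (n k : ℕ) (ω ω' : (Fin k → V n) → ℝ) : ℝ :=
  ∑ v ∈ Finset.univ.filter (fun v : Fin k → Fin (n + 1) => StrictMono v),
    (∏ j, eps n (v j)) * ω (fun j => eb n (v j)) * ω' (fun j => eb n (v j))

/-- Interior product `i_D ω = ω(D, −, …, −)` of a vector with a (raw) `k`-form. -/
def inter (n k : ℕ) (D : V n) (ω : (Fin k → V n) → ℝ) : (Fin (k - 1) → V n) → ℝ :=
  fun v => ω (fun j => if h : (j : ℕ) = 0 then D
    else v ⟨(j : ℕ) - 1, by have := j.isLt; omega⟩)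

/-- The metrically equivalent `1`-form `U* = η(U, −)`. -/
def ustar (n : ℕ) (U : V n) : V n → ℝ := fun w => mink n U w

/-- Wedge product of a `1`-form with a (raw) `k`-form:
`(α ∧ ω)(v₀,…,v_k) = Σ_j (−1)^j α(v_j) ω(v₀,…,v̂_j,…,v_k)`. -/
def wedge1 (n k : ℕ) (α : V n → ℝ) (ω : (Fin k → V n) → ℝ) : (Fin (k + 1) → V n) → ℝ :=
  fun v => ∑ j : Fin (k + 1), (-1 : ℝ) ^ (j : ℕ) * α (v j) * ω (v ∘ j.succAbove)

/-- The electric part `E_U = U* ∧ i_U ω` of a `k`-form with respect to an observer `U`. -/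
def EU (n k : ℕ) (U : V n) (ω : (Fin k → V n) → ℝ) : (Fin (k - 1 + 1) → V n) → ℝ :=
  wedge1 n (k - 1) (ustar n U) (inter n k U ω)

/-- The magnetic part `B_U = i_U (U* ∧ ω)` of a `k`-form with respect to an observer `U`. -/
def BU (n k : ℕ) (U : V n) (ω : (Fin k → V n) → ℝ) : (Fin k → V n) → ℝ :=
  inter n (k + 1) U (wedge1 n k (ustar n U) ω)

/-- Reindexing a raw form along an equality of degrees. -/
def reind (n : ℕ) {m m' : ℕ} (h : m = m') (ω : (Fin m → V n) → ℝ) : (Fin m' → V n) → ℝ :=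
  fun v => ω (fun j => v (Fin.cast h j))

/-- The energy tensor of a `k`-form:
`(−1)^{k−1} T(D₁,D₂) = ⟨i_{D₁}ω, i_{D₂}ω⟩ − (1/2)⟨ω,ω⟩ η(D₁,D₂)`. -/
def energyT (n k : ℕ) (ω : (Fin k → V n) → ℝ) (D₁ D₂ : V n) : ℝ :=
  (-1 : ℝ) ^ (k - 1) * (finner n (k - 1) (inter n k D₁ ω) (inter n k D₂ ω)
    - (1 / 2) * finner n k ω ω * mink n D₁ D₂)

/-- The volume form `dX`, with `dX(e₀,…,e_n) = 1`. -/
def dX (n : ℕ) (u : Fin (n + 1) → V n) : ℝ := Matrix.det (Matrix.of fun i j => u i j)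

/-- The Hodge star of a (raw) `k`-form:
`(*ω)(v₁,…,v_{1+n−k}) = (1/k!) Σ_{i₁,…,i_k} ε_{i₁}⋯ε_{i_k} ω(e_{i₁},…,e_{i_k})
  dX(e_{i₁},…,e_{i_k},v₁,…,v_{1+n−k})`. -/
def hodge (n k : ℕ) (ω : (Fin k → V n) → ℝ) : (Fin (n + 1 - k) → V n) → ℝ :=
  fun v => (1 / (k.factorial : ℝ)) * ∑ i : Fin k → Fin (n + 1),
    (∏ j, eps n (i j)) * ω (fun j => eb n (i j)) *
      dX n (fun l => if h : (l : ℕ) < k then eb n (i ⟨(l : ℕ), h⟩)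
        else v ⟨(l : ℕ) - k, by have := l.isLt; omega⟩)

/-- The bilinear form associated to a matrix `g`. -/
def gbil (n : ℕ) (g : Matrix (Fin (n + 1)) (Fin (n + 1)) ℝ) (x y : V n) : ℝ :=
  ∑ a, ∑ b, g a b * x a * y b

/-- The scalar product of two (raw) `k`-forms with respect to a metric `g` (indices raised
with the inverse matrix `g⁻¹`):
`⟨ω,ω̄⟩_g = (1/k!) Σ g^{i₁j₁}⋯g^{i_kj_k} ω_{i₁…i_k} ω̄_{j₁…j_k}`. -/
def ginner (n : ℕ) (g : Matrix (Fin (n + 1)) (Fin (n + 1)) ℝ) (k : ℕ)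
    (ω ω' : (Fin k → V n) → ℝ) : ℝ :=
  (1 / (k.factorial : ℝ)) * ∑ v : Fin k → Fin (n + 1), ∑ w : Fin k → Fin (n + 1),
    (∏ j, g⁻¹ (v j) (w j)) * ω (fun j => eb n (v j)) * ω' (fun j => eb n (w j))

/-- The energy tensor of a `k`-form with respect to a metric `g`:
`T(g,ω)(D₁,D₂) = (−1)^{k−1}( ⟨i_{D₁}ω, i_{D₂}ω⟩_g − (1/2)⟨ω,ω⟩_g g(D₁,D₂) )`. -/
def energyTg (n : ℕ) (g : Matrix (Fin (n + 1)) (Fin (n + 1)) ℝ) (k : ℕ)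
    (ω : (Fin k → V n) → ℝ) (D₁ D₂ : V n) : ℝ :=
  (-1 : ℝ) ^ (k - 1) * (ginner n g (k - 1) (inter n k D₁ ω) (inter n k D₂ ω)
    - (1 / 2) * ginner n g k ω ω * gbil n g D₁ D₂)

end

end Paper

namespace Paper

/-- A symmetric function of finite sequences vanishing on sequences with repetitions is determined,
in the sum over all sequences, by its values on strictly increasing sequences. -/
theorem sum_eq_factorial_mul_sum_strictMono {ι : Type*} [Fintype ι] [LinearOrder ι] (k : ℕ)
    [DecidablePred fun v : Fin k → ι => StrictMono v] (F : (Fin k → ι) → ℝ)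
    (hsymm : ∀ v (σ : Equiv.Perm (Fin k)), F (v ∘ σ) = F v)
    (hzero : ∀ v, ¬ Function.Injective v → F v = 0) :
    ∑ v, F v = (k.factorial : ℝ) *
      ∑ v ∈ Finset.univ.filter (fun v : Fin k → ι => StrictMono v), F v := by
  classical
  have hcard : ∑ _σ : Equiv.Perm (Fin k), (1 : ℝ) = k.factorial := by
    simp [Fintype.card_perm]
  rw [← hcard, Finset.sum_mul_sum, ← Finset.sum_product']
  rw [← Finset.sum_filter_of_ne (s := Finset.univ) (p := fun v : Fin k → ι => Function.Injective v)
    (fun v _ h => by by_contra hv; exact h (hzero v hv))]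
  symm
  refine Finset.sum_bij (fun p _ => p.2 ∘ p.1) ?_ ?_ ?_ ?_
  · rintro ⟨σ, v⟩ h
    have hv : StrictMono v := by simpa using h
    simpa using hv.injective
  · rintro ⟨σ, v⟩ h ⟨τ, w⟩ h' heq
    have hv : StrictMono v := by simpa using h
    have hw : StrictMono w := by simpa using h'
    have heq : v ∘ σ = w ∘ τ := heq
    have hr : Set.range v = Set.range w := by
      rw [← σ.surjective.range_comp v, ← τ.surjective.range_comp w, heq]
    obtain rfl := (hv.range_inj hw).1 hr
    have : σ = τ := Equiv.ext fun x => hv.injective (congrFun heq x)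
    rw [this]
  · intro v h
    have hv : Function.Injective v := by simpa using h
    refine ⟨((Tuple.sort v)⁻¹, v ∘ Tuple.sort v), ?_, ?_⟩
    · simpa using (Tuple.monotone_sort v).strictMono_of_injective
        (hv.comp (Tuple.sort v).injective)
    · funext x
      simp
  · rintro ⟨σ, v⟩ _
    simp [hsymm]

theorem factorial_mul_sum_alternating (n k : ℕ) (c : Fin (n + 1) → ℝ)
    [DecidablePred fun v : Fin k → Fin (n + 1) => StrictMono v]
    (f : AlternatingMap ℝ (V n) ℝ (Fin k)) :
    (k.factorial : ℝ) * ∑ v ∈ Finset.univ.filter (fun v : Fin k → Fin (n + 1) => StrictMono v),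
      (∏ j, c (v j)) * f (fun j => eb n (v j)) * f (fun j => eb n (v j)) =
    ∑ v : Fin k → Fin (n + 1),
      (∏ j, c (v j)) * f (fun j => eb n (v j)) * f (fun j => eb n (v j)) := by
  symm
  refine sum_eq_factorial_mul_sum_strictMono k _ (fun v σ => ?_) (fun v hv => ?_)
  · have h1 : ∏ j, c ((v ∘ σ) j) = ∏ j, c (v j) := Equiv.prod_comp σ fun j => c (v j)
    have h2 := f.map_perm (fun j => eb n (v j)) σ
    have h3 : f (fun j => eb n ((v ∘ σ) j)) =
        Equiv.Perm.sign σ • f (fun j => eb n (v j)) := h2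
    rw [h1, h3]
    rcases Int.units_eq_one_or (Equiv.Perm.sign σ) with h | h <;> simp [h]
  · have : f (fun j => eb n (v j)) = 0 :=
      f.map_eq_zero_of_not_injective _ fun h => hv (Function.Injective.of_comp (f := eb n) h)
    simp [this]

/-- The diagonal of the tensorial scalar product is the same in every orthonormal family. -/
theorem sum_eps_orthonormal (n k : ℕ) (A : Fin (n + 1) → V n)
    (hA : ∀ j l, ∑ i, eps n i * A i j * A i l = if j = l then eps n j else 0)
    (f : AlternatingMap ℝ (V n) ℝ (Fin k)) :
    ∑ v : Fin k → Fin (n + 1), (∏ j, eps n (v j)) * f (fun j => A (v j)) * f (fun j => A (v j)) =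
    ∑ v : Fin k → Fin (n + 1),
      (∏ j, eps n (v j)) * f (fun j => eb n (v j)) * f (fun j => eb n (v j)) := by
  classical
  have hexp : ∀ v : Fin k → Fin (n + 1), f (fun j => A (v j)) =
      ∑ w : Fin k → Fin (n + 1), (∏ j, A (v j) (w j)) * f (fun j => eb n (w j)) := by
    intro v
    have h1 : (fun j => A (v j)) = fun j => ∑ i, A (v j) i • eb n i := by
      funext j
      exact pi_eq_sum_univ' (A (v j))
    rw [h1]
    have h2 := f.toMultilinearMap.map_sum (fun j i => A (v j) i • eb n i)
    refine h2.trans (Finset.sum_congr rfl fun w _ => ?_)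
    exact f.toMultilinearMap.map_smul_univ (fun j => A (v j) (w j)) (fun j => eb n (w j))
  have hprod : ∀ w u : Fin k → Fin (n + 1),
      ∑ v : Fin k → Fin (n + 1), (∏ j, eps n (v j)) * (∏ j, A (v j) (w j)) * (∏ j, A (v j) (u j))
        = if w = u then ∏ j, eps n (w j) else 0 := by
    intro w u
    simp only [← Finset.prod_mul_distrib]
    rw [← Fintype.prod_sum (fun j i => eps n i * A i (w j) * A i (u j))]
    simp only [hA]
    by_cases h : w = u
    · subst h; simp
    · obtain ⟨j, hj⟩ := Function.ne_iff.1 h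
      rw [if_neg h]
      exact Finset.prod_eq_zero (Finset.mem_univ j) (if_neg hj)
  calc _ = ∑ v : Fin k → Fin (n + 1), ∑ w : Fin k → Fin (n + 1), ∑ u : Fin k → Fin (n + 1),
        ((∏ j, eps n (v j)) * (∏ j, A (v j) (w j)) * (∏ j, A (v j) (u j))) *
          (f (fun j => eb n (w j)) * f (fun j => eb n (u j))) := by
        refine Finset.sum_congr rfl fun v _ => ?_
        rw [hexp, mul_assoc, Finset.sum_mul_sum, Finset.mul_sum]
        refine Finset.sum_congr rfl fun w _ => ?_
        rw [Finset.mul_sum]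
        refine Finset.sum_congr rfl fun u _ => ?_
        ring
    _ = ∑ w : Fin k → Fin (n + 1), ∑ u : Fin k → Fin (n + 1),
        (if w = u then ∏ j, eps n (w j) else 0) *
          (f (fun j => eb n (w j)) * f (fun j => eb n (u j))) := by
        rw [Finset.sum_comm]
        refine Finset.sum_congr rfl fun w _ => ?_
        rw [Finset.sum_comm]
        refine Finset.sum_congr rfl fun u _ => ?_
        rw [← Finset.sum_mul, hprod]
    _ = _ := by
        simp [ite_mul, mul_assoc]

theorem factorial_mul_finner_orthonormal (n k : ℕ) (A : Fin (n + 1) → V n)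
    (hA : ∀ j l, ∑ i, eps n i * A i j * A i l = if j = l then eps n j else 0)
    (f : AlternatingMap ℝ (V n) ℝ (Fin k)) :
    (k.factorial : ℝ) * finner n k f f =
    ∑ v : Fin k → Fin (n + 1),
      (∏ j, eps n (v j)) * f (fun j => A (v j)) * f (fun j => A (v j)) := by
  rw [sum_eps_orthonormal n k A hA f]
  unfold finner
  exact factorial_mul_sum_alternating n k (eps n) f

theorem factorial_mul_finner_eq_sum_sq (n k : ℕ) (A : Fin (n + 1) → V n)
    (hA : ∀ j l, ∑ i, eps n i * A i j * A i l = if j = l then eps n j else 0)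
    (f : AlternatingMap ℝ (V n) ℝ (Fin k)) (c : ℝ)
    (hc : ∀ v : Fin k → Fin (n + 1), f (fun j => A (v j)) ≠ 0 → c * ∏ j, eps n (v j) = 1) :
    (k.factorial : ℝ) * (c * finner n k f f) =
      ∑ v : Fin k → Fin (n + 1), f (fun j => A (v j)) ^ 2 := by
  rw [mul_left_comm, factorial_mul_finner_orthonormal n k A hA f, Finset.mul_sum]
  refine Finset.sum_congr rfl fun v _ => ?_
  by_cases h : f (fun j => A (v j)) = 0
  · simp [h]
  · linear_combination f (fun j => A (v j)) ^ 2 * hc v h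

theorem eps_zero (n : ℕ) : eps n 0 = 1 := by simp [eps]

theorem eps_mul_self (n : ℕ) (i : Fin (n + 1)) : eps n i * eps n i = 1 := by
  unfold eps; split_ifs <;> norm_num

theorem prod_eps_of_ne_zero {n k : ℕ} (v : Fin k → Fin (n + 1)) (hv : ∀ j, v j ≠ 0) :
    ∏ j, eps n (v j) = (-1) ^ k := by
  simp [eps, hv]

theorem prod_eps_of_injective {n k : ℕ} (v : Fin (k + 1) → Fin (n + 1))
    (hv : Function.Injective v) (j : Fin (k + 1)) (hj : v j = 0) :
    ∏ i, eps n (v i) = (-1) ^ k := by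
  rw [Fin.prod_univ_succAbove _ j, hj, eps_zero, one_mul]
  exact prod_eps_of_ne_zero (fun i => v (j.succAbove i)) fun i h =>
    j.succAbove_ne i (hv (h.trans hj.symm))

theorem mink_add_left (n : ℕ) (x y z : V n) : mink n (x + y) z = mink n x z + mink n y z := by
  simp only [mink, ← Finset.sum_add_distrib, Pi.add_apply]
  exact Finset.sum_congr rfl fun _ _ => by ring

theorem mink_smul_left (n : ℕ) (c : ℝ) (x z : V n) : mink n (c • x) z = c * mink n x z := by
  simp only [mink, Finset.mul_sum, Pi.smul_apply, smul_eq_mul]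
  exact Finset.sum_congr rfl fun _ _ => by ring

theorem mink_comm (n : ℕ) (x y : V n) : mink n x y = mink n y x :=
  Finset.sum_congr rfl fun _ _ => by ring

theorem mink_eb_right (n : ℕ) (x : V n) (i : Fin (n + 1)) : mink n x (eb n i) = eps n i * x i := by
  simp [mink, eb, Pi.single_apply]

/-- `η` as a linear map in its first argument. -/
def minkLin (n : ℕ) (w : V n) : V n →ₗ[ℝ] ℝ where
  toFun x := mink n x w
  map_add' x y := mink_add_left n x y w
  map_smul' c x := mink_smul_left n c x w

theorem minkLin_apply (n : ℕ) (w x : V n) : minkLin n w x = mink n x w := rfl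

/-- The Lorentz reflection fixing `w` and acting as `-1` on its orthogonal complement,
when `c * η(w,w) = 2`. -/
def reflLin (n : ℕ) (c : ℝ) (w : V n) : V n →ₗ[ℝ] V n :=
  (c • minkLin n w).smulRight w - LinearMap.id

theorem reflLin_apply (n : ℕ) (c : ℝ) (w x : V n) :
    reflLin n c w x = (c * mink n x w) • w - x := rfl

theorem reflLin_involutive (n : ℕ) (c : ℝ) (w : V n) (hc : c * mink n w w = 2) :
    Function.Involutive (reflLin n c w) := by
  intro x
  have hw : reflLin n c w w = w := by
    rw [reflLin_apply, hc, two_smul, add_sub_cancel_right]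
  nth_rewrite 2 [reflLin_apply]
  rw [map_sub, map_smul, hw, reflLin_apply]
  abel

/-- Every observer is the first vector of an orthonormal basis. -/
theorem exists_orthonormal_basis (n : ℕ) (U : V n) (hU : IsObserver n U) :
    ∃ b : Module.Basis (Fin (n + 1)) ℝ (V n), b 0 = U ∧
      (∀ i, mink n U (b i) = if i = 0 then 1 else 0) ∧
      ∀ j l, ∑ i, eps n i * b i j * b i l = if j = l then eps n j else 0 := by
  obtain ⟨hUU, hU0⟩ := hU
  rw [mink_eb_right, eps_zero, one_mul] at hU0
  set w : V n := U + eb n 0 with hw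
  have hUw : mink n U w = 1 + U 0 := by
    rw [mink_comm, hw, mink_add_left, hUU, mink_comm, mink_eb_right, eps_zero, one_mul]
  have h0w : mink n (eb n 0) w = 1 + U 0 := by
    rw [mink_comm, mink_eb_right, eps_zero, hw]
    simp [eb, add_comm]
  have hww : mink n w w = 2 * (1 + U 0) := by
    nth_rewrite 1 [hw]
    rw [mink_add_left, hUw, h0w]; ring
  set c : ℝ := (1 + U 0)⁻¹ with hc
  have hne : 1 + U 0 ≠ 0 := by positivity
  have hc1 : c * (1 + U 0) = 1 := inv_mul_cancel₀ hne
  have hcw : c * mink n w w = 2 := by rw [hww]; linear_combination 2 * hc1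
  let b := (Pi.basisFun ℝ (Fin (n + 1))).map
    (LinearEquiv.ofInvolutive (reflLin n c w) (reflLin_involutive n c w hcw))
  have hb : ∀ i, b i = (c * (eps n i * w i)) • w - eb n i := by
    intro i
    have : b i = reflLin n c w (eb n i) := by simp [b, eb]
    rw [this, reflLin_apply, mink_comm, mink_eb_right]
  refine ⟨b, ?_, fun i => ?_, fun j l => ?_⟩
  · have h : w 0 = 1 + U 0 := by simp [hw, eb, add_comm]
    rw [hb, eps_zero, one_mul, h, hc1, one_smul, hw, add_sub_cancel_right]
  · have h : mink n U (b i) = c * (eps n i * w i) * mink n U w - mink n U (eb n i) := by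
      rw [hb, mink_comm, ← minkLin_apply, map_sub, map_smul, minkLin_apply, minkLin_apply,
        mink_comm n w, mink_comm n (eb n i), smul_eq_mul]
    rw [h, hUw, mink_eb_right]
    have hwi : w i = U i + if i = 0 then 1 else 0 := by simp [hw, eb, Pi.single_apply]
    have : eps n i * (if i = 0 then 1 else 0) = if i = 0 then 1 else 0 := by
      split_ifs with h
      · simp [h, eps_zero]
      · simp
    linear_combination (eps n i * w i) * hc1 + eps n i * hwi + this
  · have hterm : ∀ i, eps n i * b i j * b i l =
        c ^ 2 * w j * w l * (eps n i * w i * w i)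
          - (if j = i then c * w i * w l else 0) - (if l = i then c * w i * w j else 0)
          + (if j = i then (if l = i then eps n i else 0) else 0) := by
      intro i
      rw [hb]
      simp only [Pi.sub_apply, Pi.smul_apply, smul_eq_mul, eb, Pi.single_apply]
      have h := eps_mul_self n i
      split_ifs with h1 h2 h2
      · subst h1; subst h2
        linear_combination (c ^ 2 * eps n l * w l ^ 4 - 2 * c * w l ^ 2) * h
      · subst h1
        linear_combination (c ^ 2 * eps n j * w j ^ 3 * w l - c * w j * w l) * h
      · subst h2
        linear_combination (c ^ 2 * eps n l * w l ^ 3 * w j - c * w l * w j) * h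
      · linear_combination (c ^ 2 * eps n i * w i ^ 2 * w j * w l) * h
    simp only [hterm, Finset.sum_add_distrib, Finset.sum_sub_distrib, ← Finset.mul_sum]
    have : ∑ i, eps n i * w i * w i = mink n w w := rfl
    rw [this]
    simp only [Finset.sum_ite_eq, Finset.mem_univ, if_true, eq_comm (a := l) (b := j)]
    linear_combination c * w j * w l * hcw

theorem inter_succ (n m : ℕ) (U : V n) (ω : AlternatingMap ℝ (V n) ℝ (Fin (m + 1))) :
    inter n (m + 1) U ω = ω.curryLeft U := by
  funext v
  simp only [inter, AlternatingMap.curryLeft_apply_apply]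
  congr 1
  funext j
  refine Fin.cases ?_ (fun i => ?_) j <;> simp

/-- The wedge product `U* ∧ ω` as an alternating map. -/
def wedgeAlt (n k : ℕ) (U : V n) (ω : AlternatingMap ℝ (V n) ℝ (Fin k)) :
    AlternatingMap ℝ (V n) ℝ (Fin (k + 1)) :=
  AlternatingMap.alternatizeUncurryFin ((minkLin n U).smulRight ω)

theorem wedge1_eq_wedgeAlt (n k : ℕ) (U : V n) (ω : AlternatingMap ℝ (V n) ℝ (Fin k)) :
    wedge1 n k (ustar n U) ω = wedgeAlt n k U ω := by
  funext v
  rw [wedgeAlt, AlternatingMap.alternatizeUncurryFin_apply]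
  refine Finset.sum_congr rfl fun j _ => ?_
  simp only [ustar, LinearMap.smulRight_apply, AlternatingMap.smul_apply, minkLin_apply,
    smul_eq_mul, zsmul_eq_mul, mink_comm n U]
  push_cast
  rw [mul_assoc]
  rfl

theorem eq_zero_of_energy_eq_zero (n m : ℕ) (ω : AlternatingMap ℝ (V n) ℝ (Fin (m + 1)))
    (U : V n) (hU : IsObserver n U)
    (h : (-1 : ℝ) ^ m * finner n m (ω.curryLeft U) (ω.curryLeft U)
      + (-1 : ℝ) ^ (m + 1) * finner n (m + 1 + 1) (wedgeAlt n (m + 1) U ω)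
          (wedgeAlt n (m + 1) U ω) = 0) : ω = 0 := by
  obtain ⟨b, hb0, hbU, hA⟩ := exists_orthonormal_basis n U hU
  have hsign : ∀ k : ℕ, (-1 : ℝ) ^ k * (-1) ^ k = 1 := fun k => by
    rw [← mul_pow]; simp
  have hE := factorial_mul_finner_eq_sum_sq n m b hA (ω.curryLeft U) ((-1) ^ m) (fun v hv => by
    rw [prod_eps_of_ne_zero v, hsign]
    intro j hj
    refine hv (ω.map_eq_zero_of_eq _ (i := 0) (j := j.succ) ?_ (Fin.succ_ne_zero j).symm)
    simp [hj, hb0])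
  have hW : ∀ v : Fin (m + 1 + 1) → Fin (n + 1),
      wedgeAlt n (m + 1) U ω (fun j => b (v j)) = ∑ j : Fin (m + 1 + 1), (-1 : ℝ) ^ (j : ℕ) *
        (if v j = 0 then 1 else 0) * ω (fun i => b (v (j.succAbove i))) := by
    intro v
    rw [← wedge1_eq_wedgeAlt]
    refine Finset.sum_congr rfl fun j _ => ?_
    simp only [ustar, hbU]
    rfl
  have hB := factorial_mul_finner_eq_sum_sq n (m + 1 + 1) b hA (wedgeAlt n (m + 1) U ω)
    ((-1) ^ (m + 1)) (fun v hv => by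
      have hinj : Function.Injective v := by
        by_contra hinj
        exact hv (AlternatingMap.map_eq_zero_of_not_injective _ _ fun h =>
          hinj (Function.Injective.of_comp (f := b) h))
      by_cases hj : ∃ j, v j = 0
      · obtain ⟨j, hj⟩ := hj
        rw [prod_eps_of_injective v hinj j hj, hsign]
      · push Not at hj
        exact absurd (by rw [hW]; simp [hj]) hv)
  have hEnn : 0 ≤ (-1 : ℝ) ^ m * finner n m (ω.curryLeft U) (ω.curryLeft U) := by
    refine nonneg_of_mul_nonneg_right (hE ▸ Finset.sum_nonneg fun v _ => sq_nonneg _) ?_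
    exact_mod_cast Nat.factorial_pos m
  have hBnn : 0 ≤ (-1 : ℝ) ^ (m + 1) * finner n (m + 1 + 1) (wedgeAlt n (m + 1) U ω)
          (wedgeAlt n (m + 1) U ω) := by
    refine nonneg_of_mul_nonneg_right (hB ▸ Finset.sum_nonneg fun v _ => sq_nonneg _) ?_
    exact_mod_cast Nat.factorial_pos (m + 1 + 1)
  rw [show (-1 : ℝ) ^ m * finner n m (ω.curryLeft U) (ω.curryLeft U) = 0 by linarith,
    mul_zero, eq_comm, Finset.sum_eq_zero_iff_of_nonneg fun v _ => sq_nonneg _] at hE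
  rw [show (-1 : ℝ) ^ (m + 1) * finner n (m + 1 + 1) (wedgeAlt n (m + 1) U ω)
          (wedgeAlt n (m + 1) U ω) = 0 by linarith,
    mul_zero, eq_comm, Finset.sum_eq_zero_iff_of_nonneg fun v _ => sq_nonneg _] at hB
  refine b.ext_alternating fun v _ => ?_
  have hBv := pow_eq_zero_iff two_ne_zero |>.1 (hB (Fin.cons 0 v) (Finset.mem_univ _))
  rw [hW, Fin.sum_univ_succ] at hBv
  have hrest : ∀ j : Fin (m + 1),
      ω (fun i => b ((Fin.cons 0 v : Fin (m + 1 + 1) → Fin (n + 1)) (j.succ.succAbove i))) = 0 := by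
    intro j
    have hEv := pow_eq_zero_iff two_ne_zero |>.1
      (hE (fun i => v (j.succAbove i)) (Finset.mem_univ _))
    rw [AlternatingMap.curryLeft_apply_apply] at hEv
    rw [← hEv]
    congr 1
    funext i
    refine Fin.cases ?_ (fun i => ?_) i
    · simp [hb0]
    · simp
  simpa [hrest] using hBv

theorem isObserver_eb_zero (n : ℕ) : IsObserver n (eb n 0) := by
  have : mink n (eb n 0) (eb n 0) = 1 := by rw [mink_eb_right, eps_zero]; simp [eb]
  exact ⟨this, this ▸ one_pos⟩

theorem eq_zero_of_strictMono_eq_zero (n k : ℕ) (ω : AlternatingMap ℝ (V n) ℝ (Fin k))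
    (h : ∀ v : Fin k → Fin (n + 1), StrictMono v → ω (fun j => eb n (v j)) = 0) : ω = 0 := by
  classical
  have hs := factorial_mul_sum_alternating n k (fun _ => 1) ω
  rw [Finset.sum_eq_zero fun v hv => by rw [h v (Finset.mem_filter.1 hv).2, mul_zero], mul_zero,
    eq_comm, Finset.sum_eq_zero_iff_of_nonneg fun v _ => by
      simpa using mul_self_nonneg _] at hs
  refine (Pi.basisFun ℝ (Fin (n + 1))).ext_alternating fun v _ => ?_
  simpa [eb] using hs v (Finset.mem_univ _)

theorem sum_sq_le_energyT (n m : ℕ) (ω : AlternatingMap ℝ (V n) ℝ (Fin (m + 1)))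
    [DecidablePred fun v : Fin (m + 1) → Fin (n + 1) => StrictMono v] :
    (1 / 2) * ∑ v ∈ Finset.univ.filter (fun v : Fin (m + 1) → Fin (n + 1) => StrictMono v),
      ω (fun j => eb n (v j)) ^ 2 ≤ energyT n (m + 1) ω (eb n 0) (eb n 0) := by
  classical
  have hsign : ∀ k : ℕ, (-1 : ℝ) ^ k * (-1) ^ k = 1 := fun k => by
    rw [← mul_pow]; simp
  have hE : (-1 : ℝ) ^ m * finner n m (ω.curryLeft (eb n 0)) (ω.curryLeft (eb n 0)) =
      ∑ u ∈ Finset.univ.filter (fun u : Fin m → Fin (n + 1) => StrictMono u),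
        ω.curryLeft (eb n 0) (fun j => eb n (u j)) ^ 2 := by
    unfold finner
    rw [Finset.mul_sum]
    refine Finset.sum_congr (by congr) fun u _ => ?_
    by_cases hu : ∃ j, u j = 0
    · obtain ⟨j, hj⟩ := hu
      have : ω.curryLeft (eb n 0) (fun j => eb n (u j)) = 0 :=
        ω.map_eq_zero_of_eq _ (i := 0) (j := j.succ) (by simp [hj]) (Fin.succ_ne_zero j).symm
      simp [this]
    · push Not at hu
      rw [prod_eps_of_ne_zero u hu]
      linear_combination (ω.curryLeft (eb n 0) (fun j => eb n (u j))) ^ 2 * hsign m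
  have hN : (-1 : ℝ) ^ m * finner n (m + 1) ω ω =
      ∑ v ∈ Finset.univ.filter (fun v : Fin (m + 1) → Fin (n + 1) => StrictMono v),
        (2 * (if v 0 = 0 then ω (fun j => eb n (v j)) ^ 2 else 0)
          - ω (fun j => eb n (v j)) ^ 2) := by
    unfold finner
    rw [Finset.mul_sum]
    refine Finset.sum_congr (by congr) fun v hv => ?_
    have hv : StrictMono v := (Finset.mem_filter.1 hv).2
    split_ifs with h0
    · rw [prod_eps_of_injective v hv.injective 0 h0]
      linear_combination (ω (fun j => eb n (v j))) ^ 2 * hsign m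
    · rw [prod_eps_of_ne_zero v fun j hj => h0 (le_antisymm (hj ▸ hv.monotone (Fin.zero_le j))
        (Fin.zero_le _)), pow_succ]
      linear_combination -(ω (fun j => eb n (v j))) ^ 2 * hsign m
  have hle : ∑ v ∈ Finset.univ.filter (fun v : Fin (m + 1) → Fin (n + 1) => StrictMono v),
      (if v 0 = 0 then ω (fun j => eb n (v j)) ^ 2 else 0) ≤
      ∑ u ∈ Finset.univ.filter (fun u : Fin m → Fin (n + 1) => StrictMono u),
        ω.curryLeft (eb n 0) (fun j => eb n (u j)) ^ 2 := by
    rw [← Finset.sum_filter]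
    have hval : ∀ v : Fin (m + 1) → Fin (n + 1), v 0 = 0 →
        ω (fun j => eb n (v j)) ^ 2 =
          ω.curryLeft (eb n 0) (fun j => eb n (Fin.tail v j)) ^ 2 := by
      intro v h0
      rw [AlternatingMap.curryLeft_apply_apply]
      congr 2
      funext j
      refine Fin.cases ?_ (fun i => ?_) j
      · simp [h0]
      · simp [Fin.tail]
    rw [Finset.sum_congr rfl fun v hv => hval v (Finset.mem_filter.1 hv).2]
    rw [← Finset.sum_image (s := Finset.filter _ _)
      (g := fun v : Fin (m + 1) → Fin (n + 1) => (Fin.tail v : Fin m → Fin (n + 1)))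
      (f := fun u : Fin m → Fin (n + 1) => ω.curryLeft (eb n 0) (fun j => eb n (u j)) ^ 2)]
    · refine Finset.sum_le_sum_of_subset_of_nonneg ?_ fun _ _ _ => sq_nonneg _
      intro u hu
      obtain ⟨v, hv, rfl⟩ := Finset.mem_image.1 hu
      have hv : StrictMono v := (Finset.mem_filter.1 (Finset.mem_filter.1 hv).1).2
      exact Finset.mem_filter.2 ⟨Finset.mem_univ _, hv.comp Fin.strictMono_succ⟩
    · intro v hv w hw hvw
      have hv : v 0 = 0 := (Finset.mem_filter.1 hv).2
      have hw : w 0 = 0 := (Finset.mem_filter.1 hw).2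
      rw [← Fin.cons_self_tail v, ← Fin.cons_self_tail w, hv, hw]
      exact congrArg _ hvw
  rw [Finset.sum_sub_distrib, ← Finset.mul_sum] at hN
  have hT : energyT n (m + 1) ω (eb n 0) (eb n 0) =
      (-1 : ℝ) ^ m * finner n m (ω.curryLeft (eb n 0)) (ω.curryLeft (eb n 0))
        - (1 / 2) * ((-1 : ℝ) ^ m * finner n (m + 1) ω ω) := by
    rw [energyT, inter_succ, (isObserver_eb_zero n).1, mul_one, mul_sub, mul_left_comm (1 / 2)]
    rfl
  rw [hT, hE, hN]
  linarith

/-- for every observer the energy `e(U)` vanishes iff `ω = 0`; consequently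
the energy tensor is zero iff `ω = 0`. -/
theorem statement11 (n k : ℕ) (hn : 1 ≤ n) (hk1 : 1 ≤ k) (hk2 : k ≤ n + 1)
    (ω : AlternatingMap ℝ (V n) ℝ (Fin k)) :
    (∀ U : V n, IsObserver n U →
      ((1 / 2) * (((-1 : ℝ) ^ (k - 1) * finner n (k - 1) (inter n k U ⇑ω) (inter n k U ⇑ω))
          + ((-1 : ℝ) ^ k *
              finner n (k + 1) (wedge1 n k (ustar n U) ⇑ω) (wedge1 n k (ustar n U) ⇑ω))) = 0
        ↔ ω = 0)) ∧
    ((∀ D₁ D₂ : V n, energyT n k ⇑ω D₁ D₂ = 0) ↔ ω = 0) := by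
  classical
  obtain ⟨m, rfl⟩ : ∃ m, k = m + 1 := ⟨k - 1, by omega⟩
  refine ⟨fun U hU => ⟨fun h => ?_, ?_⟩, fun h => ?_, ?_⟩
  · rw [inter_succ, wedge1_eq_wedgeAlt] at h
    refine eq_zero_of_energy_eq_zero n m ω U hU ?_
    simpa using h
  · rintro rfl
    simp [finner, inter, wedge1]
  · have hle := sum_sq_le_energyT n m ω
    rw [h] at hle
    have hz := le_antisymm (nonpos_of_mul_nonpos_right hle (by norm_num))
      (Finset.sum_nonneg fun v _ => sq_nonneg _)
    rw [Finset.sum_eq_zero_iff_of_nonneg fun v _ => sq_nonneg _] at hz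
    refine eq_zero_of_strictMono_eq_zero n (m + 1) ω fun v hv => ?_
    exact pow_eq_zero_iff two_ne_zero |>.1 (hz v (by simpa using hv))
  · rintro rfl
    simp [energyT, finner, inter]

end Paper
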